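/- Let N ≥ 2 and k ≥ 0 be integers and let f be a nonzero holomorphic modular form of weight k for Γ₀(N) with Fourier expansion f(z) = ∑_{n ≥ h} a(n) qⁿ, a(h) = 1. Define f_θ(z) = (1/(2πi))·f′(z)/f(z) + ((k/12 − h)/(N − 1))·N·E₂(Nz) + ((h − N·k/12)/(N − 1))·E₂(z), where f′ is the complex derivative of f on the upper half-plane. Then f_θ is holomorphic at every point z ∈ ℍ with f(z) ≠ 0, and it transforms as a modular form of weight 2 for Γ₀(N): for every γ = (a b; c d) ∈ Γ₀(N) and every z ∈ ℍ with f(z) ≠ 0, one has f(γz) ≠ 0 and f_θ(γz) = (cz + d)² f_θ(z). -/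

import Mathlib

open Complex UpperHalfPlane Real
open scoped MatrixGroups

/-- The normalized quasimodular Eisenstein series of weight 2,
`E₂(z) = 1 - 24 ∑_{n ≥ 1} σ₁(n) e^{2πinz}`, as a function on ℂ. -/
noncomputable def E2 (z : ℂ) : ℂ :=
  1 - 24 * ∑' n : ℕ,
    ((ArithmeticFunction.sigma 1 n : ℕ) : ℂ) * Complex.exp (2 * Real.pi * Complex.I * n * z)

theorem E2_coe (z : ℍ) : E2 (z : ℂ) = EisensteinSeries.E2 z := by
  rw [EisensteinSeries.E2_eq_tsum_cexp, E2]
  congr 2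
  rw [← Function.Injective.tsum_eq PNat.coe_injective]
  · refine tsum_congr fun n ↦ ?_
    rw [← Complex.exp_nat_mul]
    ring_nf
  · intro n hn
    rcases Nat.eq_zero_or_pos n with rfl | hpos
    · simp at hn
    · exact ⟨⟨n, hpos⟩, rfl⟩

theorem differentiableAt_E2 {w : ℂ} (hw : 0 < w.im) : DifferentiableAt ℂ E2 w := by
  have hE := UpperHalfPlane.mdifferentiableAt_iff.mp (E2_mdifferentiable ⟨w, hw⟩)
  refine hE.congr_of_eventuallyEq ?_
  filter_upwards [isOpen_upperHalfPlaneSet.mem_nhds hw] with v hv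
  simp [ofComplex_apply_of_im_pos hv, ← E2_coe]

/-- The quasimodular transformation law of `E2` under `SL(2, ℤ)`. -/
theorem E2_smul (γ : SL(2, ℤ)) (z : ℍ) :
    E2 ((γ • z : ℍ) : ℂ) =
      ((γ 1 0 : ℤ) * (z : ℂ) + (γ 1 1 : ℤ)) ^ 2 * E2 z +
        12 / (2 * π * Complex.I) * (γ 1 0 : ℤ) * ((γ 1 0 : ℤ) * (z : ℂ) + (γ 1 1 : ℤ)) := by
  have hd : denom γ z = (γ 1 0 : ℤ) * (z : ℂ) + (γ 1 1 : ℤ) := ModularGroup.denom_apply γ z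
  have hne : denom γ z ≠ 0 := denom_ne_zero _ _
  have h := congrFun (EisensteinSeries.E2_slash_action γ) z
  rw [ModularForm.SL_slash_apply] at h
  simp only [Pi.sub_apply, Pi.smul_apply, smul_eq_mul, EisensteinSeries.D2, riemannZeta_two,
    ← E2_coe] at h
  rw [← hd]
  have hpi : (π : ℂ) ≠ 0 := by exact_mod_cast Real.pi_ne_zero
  rw [zpow_neg, ← div_eq_mul_inv, div_eq_iff (zpow_ne_zero _ hne)] at h
  rw [h]
  field_simp
  linear_combination (-12 * (γ 1 0 : ℂ)) * Complex.I_sq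

theorem coe_SL_smul (γ : SL(2, ℤ)) (z : ℍ) :
    ((γ • z : ℍ) : ℂ) = ((γ 0 0 : ℤ) * (z : ℂ) + (γ 0 1 : ℤ)) /
      ((γ 1 0 : ℤ) * (z : ℂ) + (γ 1 1 : ℤ)) := by
  rw [coe_specialLinearGroup_apply]
  simp

theorem natCast_mul_E2_smul {N : ℕ} (hN : 0 < N) {γ : SL(2, ℤ)}
    (hγ : γ ∈ CongruenceSubgroup.Gamma0 N) (z : ℍ) :
    (N : ℂ) * E2 (N * ((γ • z : ℍ) : ℂ)) =
      ((γ 1 0 : ℤ) * (z : ℂ) + (γ 1 1 : ℤ)) ^ 2 * (N * E2 (N * z)) +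
        12 / (2 * π * Complex.I) * (γ 1 0 : ℤ) * ((γ 1 0 : ℤ) * (z : ℂ) + (γ 1 1 : ℤ)) := by
  have hN0 : (N : ℂ) ≠ 0 := by exact_mod_cast hN.ne'
  obtain ⟨c, hc⟩ := (ZMod.intCast_zmod_eq_zero_iff_dvd _ _).mp (CongruenceSubgroup.Gamma0_mem.mp hγ)
  have hdet := Matrix.det_fin_two γ.1
  rw [γ.2] at hdet
  let δ : SL(2, ℤ) := ⟨!![γ 0 0, γ 0 1 * N; c, γ 1 1], by
    rw [Matrix.det_fin_two_of]
    linear_combination -hdet + γ 0 1 * hc⟩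
  let Nz : ℍ := ⟨N * z, by simpa using mul_pos (Nat.cast_pos.mpr hN) z.im_pos⟩
  have hNz : (Nz : ℂ) = N * z := rfl
  have hcC : ((γ 1 0 : ℤ) : ℂ) = N * c := by rw [hc]; push_cast; rfl
  have hden : ((δ 1 0 : ℤ) : ℂ) * Nz + (δ 1 1 : ℤ) = (γ 1 0 : ℤ) * (z : ℂ) + (γ 1 1 : ℤ) := by
    simp only [δ, hNz, hcC, Matrix.of_apply, Matrix.cons_val', Matrix.cons_val_zero,
      Matrix.cons_val_one, Matrix.cons_val_fin_one]
    ring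
  have hsmul : ((δ • Nz : ℍ) : ℂ) = N * ((γ • z : ℍ) : ℂ) := by
    rw [coe_SL_smul, coe_SL_smul, hden, ← mul_div_assoc]
    congr 1
    simp [δ, hNz]
    ring
  have h := E2_smul δ Nz
  rw [hsmul, hden, hNz] at h
  have hδ : ((δ 1 0 : ℤ) : ℂ) = c := by simp [δ]
  rw [h, hδ, hcC]
  ring

/-- The logarithmic derivative of a function that transforms with weight `k` under `γ`. -/
theorem logDeriv_smul_of_slash_invariant {F : ℂ → ℂ}
    (hF : DifferentiableOn ℂ F {w : ℂ | 0 < w.im}) (k : ℤ) (γ : SL(2, ℤ))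
    (hγ : ∀ z : ℍ, F ((γ • z : ℍ) : ℂ) =
      ((γ 1 0 : ℤ) * (z : ℂ) + (γ 1 1 : ℤ)) ^ k * F z) (z : ℍ) (hz : F z ≠ 0) :
    deriv F ((γ • z : ℍ) : ℂ) / F ((γ • z : ℍ) : ℂ) =
      ((γ 1 0 : ℤ) * (z : ℂ) + (γ 1 1 : ℤ)) ^ 2 * (deriv F z / F z) +
        k * (γ 1 0 : ℤ) * ((γ 1 0 : ℤ) * (z : ℂ) + (γ 1 1 : ℤ)) := by
  have hopen : IsOpen {w : ℂ | 0 < w.im} := isOpen_upperHalfPlaneSet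
  have hdiff (τ : ℍ) : HasDerivAt F (deriv F τ) τ :=
    (hF.differentiableAt (hopen.mem_nhds τ.im_pos)).hasDerivAt
  have hne : ((γ 1 0 : ℤ) : ℂ) * (z : ℂ) + (γ 1 1 : ℤ) ≠ 0 := by
    rw [← ModularGroup.denom_apply]
    exact denom_ne_zero _ _
  have hdet : ((γ 0 0 : ℤ) : ℂ) * (γ 1 1 : ℤ) - (γ 0 1 : ℤ) * (γ 1 0 : ℤ) = 1 := by
    have := Matrix.det_fin_two γ.1
    rw [γ.2] at this
    exact_mod_cast this.symm
  have hlin (a b : ℂ) : HasDerivAt (fun w : ℂ ↦ a * w + b) a z := by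
    simpa using ((hasDerivAt_id (z : ℂ)).const_mul a).add_const b
  have hM := (hlin (γ 0 0 : ℤ) (γ 0 1 : ℤ)).div (hlin (γ 1 0 : ℤ) (γ 1 1 : ℤ)) hne
  have hleft := HasDerivAt.comp (z : ℂ) (coe_SL_smul γ z ▸ hdiff (γ • z)) hM
  have hpow := (hasDerivAt_zpow k _ (Or.inl hne)).comp (z : ℂ) (hlin (γ 1 0 : ℤ) (γ 1 1 : ℤ))
  have hright := hpow.mul (hdiff z)
  have heq := hleft.unique (hright.congr_of_eventuallyEq (by
    filter_upwards [hopen.mem_nhds z.im_pos] with w hw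
    have := hγ ⟨w, hw⟩
    rw [coe_SL_smul] at this
    exact this))
  rw [← coe_SL_smul] at heq
  rw [hγ z]
  generalize deriv F ((γ • z : ℍ) : ℂ) = A at heq ⊢
  simp only [Function.comp_apply] at heq
  generalize hj : ((γ 1 0 : ℤ) : ℂ) * (z : ℂ) + (γ 1 1 : ℤ) = j at *
  have hnum : ((γ 0 0 : ℤ) : ℂ) * j - ((γ 0 0 : ℤ) * (z : ℂ) + (γ 0 1 : ℤ)) * (γ 1 0 : ℤ) = 1 := by
    rw [← hj, ← hdet]
    ring
  rw [hnum, zpow_sub_one₀ hne] at heq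
  have hjk : j ^ k ≠ 0 := zpow_ne_zero _ hne
  rw [div_eq_iff (mul_ne_zero hjk hz)]
  field_simp at heq ⊢
  rw [heq]
  ring

theorem stmt3 (N : ℕ) (hN : 2 ≤ N) (k : ℤ) (hk : 0 ≤ k)
    (f : ModularForm (CongruenceSubgroup.Gamma0 N) k) (hf_ne : f ≠ 0)
    (h : ℕ) (a : ℕ → ℂ) (ha : a 0 = 1)
    (hfexp : ∀ z : UpperHalfPlane,
      f z = ∑' n : ℕ, a n * Complex.exp (2 * Real.pi * Complex.I * ((n : ℂ) + h) * z))
    -- `F` is a holomorphic function on the open upper half-plane in ℂ agreeing with `f`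
    (F : ℂ → ℂ) (hF_holo : DifferentiableOn ℂ F {w : ℂ | 0 < w.im})
    (hFf : ∀ z : UpperHalfPlane, F (z : ℂ) = f z)
    -- the function f_θ
    (fθ : ℂ → ℂ)
    (hfθ : ∀ w : ℂ, fθ w =
      (1 / (2 * Real.pi * Complex.I)) * deriv F w / F w +
        (((k : ℂ) / 12 - (h : ℂ)) / ((N : ℂ) - 1)) * (N : ℂ) * E2 ((N : ℂ) * w) +
        (((h : ℂ) - (N : ℂ) * (k : ℂ) / 12) / ((N : ℂ) - 1)) * E2 w) :
    (∀ z : UpperHalfPlane, f z ≠ 0 → DifferentiableAt ℂ fθ (z : ℂ)) ∧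
    (∀ γ : SL(2, ℤ), γ ∈ CongruenceSubgroup.Gamma0 N → ∀ z : UpperHalfPlane, f z ≠ 0 →
      f (γ • z) ≠ 0 ∧
      fθ ((γ • z : UpperHalfPlane) : ℂ) =
        ((γ 1 0 : ℤ) * (z : ℂ) + (γ 1 1 : ℤ)) ^ 2 * fθ (z : ℂ)) := by
  have hN0 : 0 < N := by omega
  have hN1 : (N : ℂ) - 1 ≠ 0 := sub_ne_zero.mpr (by exact_mod_cast (by omega : N ≠ 1))
  constructor
  · intro z hz
    have hFz : F z ≠ 0 := by rwa [hFf]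
    have hnhds := isOpen_upperHalfPlaneSet.mem_nhds z.im_pos
    have hF := hF_holo.differentiableAt hnhds
    have hF' := (hF_holo.deriv isOpen_upperHalfPlaneSet).differentiableAt hnhds
    have hE := differentiableAt_E2 z.im_pos
    have hNz : 0 < ((N : ℂ) * z).im := by
      simpa using mul_pos (Nat.cast_pos.mpr hN0) z.im_pos
    have hEN : DifferentiableAt ℂ (fun w ↦ E2 (N * w)) z :=
      (differentiableAt_E2 hNz).comp (z : ℂ) (differentiableAt_id.const_mul (N : ℂ))
    rw [funext hfθ]
    exact (((hF'.const_mul _).div hF hFz).add (hEN.const_mul _)).add (hE.const_mul _)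
  · intro γ hγ z hz
    have hf (τ : ℍ) : f (γ • τ) = ((γ 1 0 : ℤ) * (τ : ℂ) + (γ 1 1 : ℤ)) ^ k * f τ := by
      rw [← ModularGroup.denom_apply]
      exact SlashInvariantForm.slash_action_eqn_SL'' f hγ τ
    have hne : ((γ 1 0 : ℤ) : ℂ) * (z : ℂ) + (γ 1 1 : ℤ) ≠ 0 := by
      rw [← ModularGroup.denom_apply]
      exact denom_ne_zero _ _
    refine ⟨by rw [hf]; exact mul_ne_zero (zpow_ne_zero _ hne) hz, ?_⟩
    have hlog := logDeriv_smul_of_slash_invariant hF_holo k γ (by simpa only [hFf] using hf) z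
      (by rwa [hFf])
    rw [hfθ, hfθ, mul_div_assoc, mul_div_assoc, hlog, mul_assoc _ (N : ℂ), mul_assoc _ (N : ℂ),
      natCast_mul_E2_smul hN0 hγ, E2_smul]
    have hpi : (2 * π * Complex.I : ℂ) ≠ 0 := Complex.two_pi_I_ne_zero
    generalize (2 * π * Complex.I : ℂ) = p at *
    field_simp
    ring
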